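/- The elements a = z_1 z_4* − z_2 z_3*, b = z_1 z_3 + q^{-1} z_2 z_4 and R = z_1 z_1* + z_2 z_2* of A(S^7_q) are coinvariant for Δ_r, i.e. Δ_r(a) = a ⊗ r(1), Δ_r(b) = b ⊗ r(1), Δ_r(R) = R ⊗ r(1); hence a, a*, b, b*, R belong to A(Σ^4_q). -/

import Mathlib

open scoped TensorProduct

noncomputable section

namespace QIB

/-- Generators of `A(U_q(4))`: the matrix entries `t i j` and the extra generator `D_q⁻¹`. -/
abbrev genU : Type := (Fin 4 × Fin 4) ⊕ Unit

abbrev FU : Type := FreeAlgebra ℂ genU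

def T (i j : Fin 4) : FU := FreeAlgebra.ι ℂ (Sum.inl (i, j))

def Dinv0 : FU := FreeAlgebra.ι ℂ (Sum.inr ())

/-- The length (number of inversions) of a permutation of `Fin 4`. -/
def plen (σ : Equiv.Perm (Fin 4)) : ℕ :=
  ((Finset.univ : Finset (Fin 4 × Fin 4)).filter fun p => p.1 < p.2 ∧ σ p.2 < σ p.1).card

/-- The quantum determinant, as an element of the free algebra. -/
def Dq0 (q : ℝ) : FU :=
  ∑ σ : Equiv.Perm (Fin 4),
    ((-(q : ℂ)) ^ plen σ) • (T (σ 0) 0 * T (σ 1) 1 * T (σ 2) 2 * T (σ 3) 3)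

/-- The defining relations of `A(U_q(4))`. -/
inductive relU (q : ℝ) : FU → FU → Prop
  | col {i j k : Fin 4} : i < j → relU q (T i k * T j k) ((q : ℂ) • (T j k * T i k))
  | row {i j k : Fin 4} : i < j → relU q (T k i * T k j) ((q : ℂ) • (T k j * T k i))
  | comm {i j k l : Fin 4} : i < j → k < l → relU q (T i l * T j k) (T j k * T i l)
  | qcom {i j k l : Fin 4} : i < j → k < l →
      relU q (T i k * T j l - T j l * T i k) (((q : ℂ) - (q : ℂ)⁻¹) • (T j k * T i l))
  | dr : relU q (Dq0 q * Dinv0) 1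
  | dl : relU q (Dinv0 * Dq0 q) 1

variable (q : ℝ)

/-- The algebra `A(U_q(4))`. -/
abbrev AU : Type := RingQuot (relU q)

/-- The generators `t i j` of `A(U_q(4))` (indices are 0-based). -/
def tt (i j : Fin 4) : AU q := RingQuot.mkAlgHom ℂ (relU q) (T i j)

/-- The generator `D_q⁻¹`. -/
def dI : AU q := RingQuot.mkAlgHom ℂ (relU q) Dinv0

/-- The quantum determinant `D_q` in `A(U_q(4))`. -/
def Dq : AU q := RingQuot.mkAlgHom ℂ (relU q) (Dq0 q)

/-- The spanning set `R` of relation elements (0-based indices). -/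
def Rset : Set (AU q) :=
  {tt q 0 2, tt q 2 0, tt q 0 3, tt q 3 0, tt q 1 3, tt q 3 1, tt q 1 2, tt q 2 1,
   tt q 0 0 - tt q 3 3, tt q 0 1 + tt q 3 2, tt q 1 0 + tt q 2 3, tt q 1 1 - tt q 2 2,
   tt q 0 0 * tt q 1 1 - (q : ℂ) • (tt q 0 1 * tt q 1 0) - 1}

/-- The right ideal `ℛ = R · A(U_q(4))`, as a `ℂ`-submodule. -/
def RIdeal : Submodule ℂ (AU q) :=
  Submodule.span ℂ {y | ∃ x ∈ Rset q, ∃ a : AU q, y = x * a}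

/-- The coalgebra `C = A(U_q(4)) / ℛ`. -/
abbrev Cq : Type := AU q ⧸ RIdeal q

/-- The canonical projection `r : A(U_q(4)) → C`. -/
def rr : AU q →ₗ[ℂ] Cq q := (RIdeal q).mkQ

lemma RIdeal_mul_right {y : AU q} (hy : y ∈ RIdeal q) (c : AU q) : y * c ∈ RIdeal q := by
  induction hy using Submodule.span_induction with
  | mem x hx =>
      obtain ⟨x0, hx0, a, rfl⟩ := hx
      exact Submodule.subset_span ⟨x0, hx0, a * c, by rw [mul_assoc]⟩
  | zero => simp
  | add u v _ _ hu hv => simpa [add_mul] using (RIdeal q).add_mem hu hv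
  | smul a u _ hu => simpa [smul_mul_assoc] using (RIdeal q).smul_mem a hu

/-- Auxiliary map for the right `A(U_q(4))`-module structure of `C`:
right multiplication by `c` descends to the quotient. -/
def cactAux (c : AU q) : Cq q →ₗ[ℂ] Cq q :=
  Submodule.liftQ (RIdeal q) ((RIdeal q).mkQ ∘ₗ LinearMap.mulRight ℂ c)
    (by
      intro y hy
      simp only [LinearMap.mem_ker, LinearMap.comp_apply, LinearMap.mulRight_apply,
        Submodule.mkQ_apply, Submodule.Quotient.mk_eq_zero]
      exact RIdeal_mul_right q hy c)

@[simp] lemma cactAux_mk (c a : AU q) :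
    cactAux q c (Submodule.Quotient.mk a) = (Submodule.Quotient.mk (a * c) : Cq q) := by
  simp [cactAux]

/-- The right `A(U_q(4))`-module structure `r(t) · t' := r(t t')` of `C`,
as a bilinear map `A(U_q(4)) →ₗ C →ₗ C`, `(c, x) ↦ x · c`. -/
def cact : AU q →ₗ[ℂ] Cq q →ₗ[ℂ] Cq q where
  toFun c := cactAux q c
  map_add' c c' := by
    refine LinearMap.ext fun x => ?_
    obtain ⟨a, rfl⟩ := Submodule.Quotient.mk_surjective _ x
    simp only [cactAux_mk, mul_add, Submodule.Quotient.mk_add, LinearMap.add_apply]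
  map_smul' s c := by
    refine LinearMap.ext fun x => ?_
    obtain ⟨a, rfl⟩ := Submodule.Quotient.mk_surjective _ x
    simp only [cactAux_mk, mul_smul_comm, Submodule.Quotient.mk_smul, RingHom.id_apply, LinearMap.smul_apply]

@[simp] lemma cact_mk (c a : AU q) : cact q c (rr q a) = rr q (a * c) := by
  simp [cact, rr]

/-- θ(k) = 1 for k ≥ 0 and 0 for k < 0. -/
def thetaZ (k : ℤ) : ℂ := if 0 ≤ k then 1 else 0

/-- The linear basis elements `r^{k,m,n}` of `C`, given as representatives in `A(U_q(4))`. -/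
def bas (k : ℤ) (m n : ℕ) : AU q :=
  if 0 ≤ k then tt q 0 0 ^ k.toNat * tt q 0 1 ^ m * tt q 1 0 ^ n
  else tt q 0 1 ^ m * tt q 1 0 ^ n * tt q 1 1 ^ (-k).toNat

/-! ### The quantum seven-sphere -/

/-- Generators of `A(S⁷_q)`: `(i, false)` is `z_i`, `(i, true)` is `z_i^*`. -/
abbrev genS : Type := Fin 4 × Bool

abbrev FS : Type := FreeAlgebra ℂ genS

def Z0 (i : Fin 4) : FS := FreeAlgebra.ι ℂ (i, false)

def Zs0 (i : Fin 4) : FS := FreeAlgebra.ι ℂ (i, true)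

/-- The defining relations of the ∗-algebra `A(S⁷_q)` (including the ∗-conjugate of the
first family of relations, so that the relation set is closed under the involution). -/
inductive relS (q : ℝ) : FS → FS → Prop
  | zz {i j : Fin 4} : i < j → relS q (Z0 i * Z0 j) ((q : ℂ) • (Z0 j * Z0 i))
  | ss {i j : Fin 4} : i < j → relS q (Zs0 j * Zs0 i) ((q : ℂ) • (Zs0 i * Zs0 j))
  | sz {i j : Fin 4} : i ≠ j → relS q (Zs0 j * Z0 i) ((q : ℂ) • (Z0 i * Zs0 j))
  | szz {k : Fin 4} : relS q (Zs0 k * Z0 k)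
      (Z0 k * Zs0 k + (1 - (q : ℂ) ^ 2) •
        ∑ j ∈ Finset.univ.filter (· < k), Z0 j * Zs0 j)
  | sum1 : relS q (∑ k : Fin 4, Z0 k * Zs0 k) 1

/-- The algebra `P = A(S⁷_q)`. -/
abbrev PA : Type := RingQuot (relS q)

/-- The generators `z_i` of `A(S⁷_q)` (0-based index). -/
def z (i : Fin 4) : PA q := RingQuot.mkAlgHom ℂ (relS q) (Z0 i)

/-- The generators `z_i^*` of `A(S⁷_q)` (0-based index). -/
def zs (i : Fin 4) : PA q := RingQuot.mkAlgHom ℂ (relS q) (Zs0 i)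

/-- The element `R = z₁ z₁^* + z₂ z₂^*` of `A(S⁷_q)`. -/
def RRe [StarRing (PA q)] : PA q := z q 0 * star (z q 0) + z q 1 * star (z q 1)

/-- The element `a = z₁ z₄^* − z₂ z₃^*` of `A(S⁷_q)`. -/
def aa [StarRing (PA q)] : PA q := z q 0 * star (z q 3) - z q 1 * star (z q 2)

/-- The element `b = z₁ z₃ + q⁻¹ z₂ z₄` of `A(S⁷_q)`. -/
def bb : PA q := z q 0 * z q 2 + (q : ℂ)⁻¹ • (z q 1 * z q 3)

/-- The elements `a_n = z₁ z₄^* − qⁿ z₂ z₃^*` of `A(S⁷_q)`. -/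
def aN [StarRing (PA q)] (n : ℤ) : PA q :=
  z q 0 * star (z q 3) - ((q : ℂ) ^ n) • (z q 1 * star (z q 2))

/-- The elements `b_n = z₁ z₃ + q^{n−1} z₂ z₄` of `A(S⁷_q)`. -/
def bN (n : ℤ) : PA q := z q 0 * z q 2 + ((q : ℂ) ^ (n - 1)) • (z q 1 * z q 3)

/-! ### The coaction, the coinvariants and the canonical map -/

variable (δ : PA q →ₐ[ℂ] PA q ⊗[ℂ] AU q)

/-- `Δ_r := (id ⊗ r) ∘ Δ : A(S⁷_q) → A(S⁷_q) ⊗ C`, built from the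
`A(U_q(4))`-coaction `δ`. -/
def Dr : PA q →ₗ[ℂ] PA q ⊗[ℂ] Cq q :=
  (LinearMap.lTensor (PA q) (rr q)) ∘ₗ δ.toLinearMap

/-- The set of coinvariants `B = A(Σ⁴_q) = {a | Δ_r(a) = a ⊗ r(1)}`. -/
def Bset : Set (PA q) := {a : PA q | Dr q δ a = a ⊗ₜ[ℂ] rr q 1}

/-- The subspace of `P ⊗ P` spanned by the elements `(u b) ⊗ v − u ⊗ (b v)` with `b`
a coinvariant; quotienting by it produces the balanced tensor product `P ⊗_B P`. -/
def relT : Submodule ℂ (PA q ⊗[ℂ] PA q) :=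
  Submodule.span ℂ
    {x : PA q ⊗[ℂ] PA q | ∃ u v b : PA q, b ∈ Bset q δ ∧
      x = (u * b) ⊗ₜ[ℂ] v - u ⊗ₜ[ℂ] (b * v)}

set_option maxSynthPendingDepth 3

/-- The balanced tensor product `P ⊗_B P` over the coinvariant subalgebra `B = A(Σ⁴_q)`. -/
abbrev PBP : Type := (PA q ⊗[ℂ] PA q) ⧸ relT q δ

/-- The canonical projection `P ⊗ P → P ⊗_B P`. -/
def mkT : PA q ⊗[ℂ] PA q →ₗ[ℂ] PBP q δ := (relT q δ).mkQ

lemma relT_map_lmul (p : PA q) {x : PA q ⊗[ℂ] PA q} (hx : x ∈ relT q δ) :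
    TensorProduct.map (LinearMap.mulLeft ℂ p) LinearMap.id x ∈ relT q δ := by
  induction hx using Submodule.span_induction with
  | mem y hy =>
      obtain ⟨u, v, b, hb, rfl⟩ := hy
      refine Submodule.subset_span ⟨p * u, v, b, hb, ?_⟩
      simp [TensorProduct.map_tmul, mul_assoc]
  | zero => simp
  | add u v _ _ hu hv => simpa [map_add] using Submodule.add_mem _ hu hv
  | smul a u _ hu => simpa [map_smul] using Submodule.smul_mem _ a hu

lemma relT_map_rmul (p : PA q) {x : PA q ⊗[ℂ] PA q} (hx : x ∈ relT q δ) :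
    TensorProduct.map LinearMap.id (LinearMap.mulRight ℂ p) x ∈ relT q δ := by
  induction hx using Submodule.span_induction with
  | mem y hy =>
      obtain ⟨u, v, b, hb, rfl⟩ := hy
      refine Submodule.subset_span ⟨u, v * p, b, hb, ?_⟩
      simp [TensorProduct.map_tmul, mul_assoc]
  | zero => simp
  | add u v _ _ hu hv => simpa [map_add] using Submodule.add_mem _ hu hv
  | smul a u _ hu => simpa [map_smul] using Submodule.smul_mem _ a hu

/-- Left multiplication by `p ∈ P` on the bimodule `P ⊗_B P`. -/
def lact (p : PA q) : PBP q δ →ₗ[ℂ] PBP q δ :=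
  Submodule.liftQ (relT q δ)
    ((relT q δ).mkQ ∘ₗ TensorProduct.map (LinearMap.mulLeft ℂ p) LinearMap.id)
    (by
      intro x hx
      simp only [LinearMap.mem_ker, LinearMap.comp_apply, Submodule.mkQ_apply,
        Submodule.Quotient.mk_eq_zero]
      exact relT_map_lmul q δ p hx)

/-- Right multiplication by `p ∈ P` on the bimodule `P ⊗_B P`. -/
def ract (p : PA q) : PBP q δ →ₗ[ℂ] PBP q δ :=
  Submodule.liftQ (relT q δ)
    ((relT q δ).mkQ ∘ₗ TensorProduct.map LinearMap.id (LinearMap.mulRight ℂ p))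
    (by
      intro x hx
      simp only [LinearMap.mem_ker, LinearMap.comp_apply, Submodule.mkQ_apply,
        Submodule.Quotient.mk_eq_zero]
      exact relT_map_rmul q δ p hx)

/-- The structure map of the right action `◁` of `A(S⁷_q)` on `A(S⁷_q) ⊗ C`:
on simple tensors, `(u ⊗ x) ⊗ (w ⊗ y) ↦ (u w) ⊗ (x · y)`.  The action is
`(u ⊗ x) ◁ v = triMap ((u ⊗ x) ⊗ δ v) = Σ u v₍₀₎ ⊗ x · v₍₁₎`. -/
def triMap : (PA q ⊗[ℂ] Cq q) ⊗[ℂ] (PA q ⊗[ℂ] AU q) →ₗ[ℂ] PA q ⊗[ℂ] Cq q :=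
  (TensorProduct.map (LinearMap.mul' ℂ (PA q)) (TensorProduct.lift (LinearMap.flip (cact q)))) ∘ₗ
    (TensorProduct.tensorTensorTensorComm ℂ (PA q) (Cq q) (PA q) (AU q)).toLinearMap

section helpers

lemma tt_col {i j k : Fin 4} (h : i < j) :
    tt q i k * tt q j k = (q : ℂ) • (tt q j k * tt q i k) := by
  have := RingQuot.mkAlgHom_rel ℂ (relU.col (q := q) (k := k) h)
  rw [map_smul, map_mul, map_mul] at this
  exact this

lemma tt_row {i j k : Fin 4} (h : i < j) :
    tt q k i * tt q k j = (q : ℂ) • (tt q k j * tt q k i) := by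
  have := RingQuot.mkAlgHom_rel ℂ (relU.row (q := q) (k := k) h)
  rw [map_smul, map_mul, map_mul] at this
  exact this

lemma tt_comm {i j k l : Fin 4} (h : i < j) (h' : k < l) :
    tt q i l * tt q j k = tt q j k * tt q i l := by
  simpa [tt] using RingQuot.mkAlgHom_rel ℂ (relU.comm (q := q) h h')

lemma tt_qcom {i j k l : Fin 4} (h : i < j) (h' : k < l) :
    tt q i k * tt q j l =
      tt q j l * tt q i k + ((q : ℂ) - (q : ℂ)⁻¹) • (tt q j k * tt q i l) := by
  have := RingQuot.mkAlgHom_rel ℂ (relU.qcom (q := q) h h')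
  rw [map_sub, map_smul, map_mul, map_mul, map_mul] at this
  exact sub_eq_iff_eq_add'.mp this

lemma rr_mem {x : AU q} (hx : x ∈ Rset q) (c : AU q) : rr q (x * c) = 0 := by
  rw [rr, Submodule.mkQ_apply, Submodule.Quotient.mk_eq_zero]
  exact Submodule.subset_span ⟨x, hx, c, rfl⟩

lemma rr_congr {x y : AU q} (h : rr q x = rr q y) (c : AU q) : rr q (x * c) = rr q (y * c) := by
  rw [← cact_mk, h, cact_mk]

lemma rr_zero {i j : Fin 4} (h : (i < 2 ∧ 2 ≤ j) ∨ (2 ≤ i ∧ j < 2)) (c : AU q) :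
    rr q (tt q i j * c) = 0 := by
  apply rr_mem
  fin_cases i <;> fin_cases j <;> first | (exfalso; revert h; decide) | simp [Rset]

lemma rr_33 (c : AU q) : rr q (tt q 3 3 * c) = rr q (tt q 0 0 * c) := by
  have := rr_mem q (x := tt q 0 0 - tt q 3 3) (by simp [Rset]) c
  rw [sub_mul, map_sub, sub_eq_zero] at this
  exact this.symm

lemma rr_22 (c : AU q) : rr q (tt q 2 2 * c) = rr q (tt q 1 1 * c) := by
  have := rr_mem q (x := tt q 1 1 - tt q 2 2) (by simp [Rset]) c
  rw [sub_mul, map_sub, sub_eq_zero] at this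
  exact this.symm

lemma rr_32 (c : AU q) : rr q (tt q 3 2 * c) = - rr q (tt q 0 1 * c) := by
  have := rr_mem q (x := tt q 0 1 + tt q 3 2) (by simp [Rset]) c
  rw [add_mul, map_add] at this
  exact eq_neg_of_add_eq_zero_right this

lemma rr_23 (c : AU q) : rr q (tt q 2 3 * c) = - rr q (tt q 1 0 * c) := by
  have := rr_mem q (x := tt q 1 0 + tt q 2 3) (by simp [Rset]) c
  rw [add_mul, map_add] at this
  exact eq_neg_of_add_eq_zero_right this

lemma rr_det : rr q (tt q 0 0 * tt q 1 1) = (q : ℂ) • rr q (tt q 0 1 * tt q 1 0) + rr q 1 := by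
  have := rr_mem q
    (x := tt q 0 0 * tt q 1 1 - (q : ℂ) • (tt q 0 1 * tt q 1 0) - 1) (by simp [Rset]) 1
  rw [mul_one, map_sub, map_sub, map_smul, sub_eq_zero] at this
  rw [← this]; abel

/-- Commuting the diagonal blocks modulo the right ideal. -/
lemma rr_swap {i m k l : Fin 4} (hi : i < 2) (hm : m < 2) (hk : 2 ≤ k) (hl : 2 ≤ l) :
    rr q (tt q i m * tt q k l) = rr q (tt q k l * tt q i m) := by
  rw [tt_qcom q (hi.trans_le hk) (hm.trans_le hl), map_add, map_smul,
    rr_zero q (Or.inr ⟨hk, hm⟩), smul_zero, add_zero]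

lemma sw_22 {i m : Fin 4} (hi : i < 2) (hm : m < 2) :
    rr q (tt q i m * tt q 2 2) = rr q (tt q 1 1 * tt q i m) := by
  rw [rr_swap q hi hm (by decide) (by decide), rr_22]

lemma sw_33 {i m : Fin 4} (hi : i < 2) (hm : m < 2) :
    rr q (tt q i m * tt q 3 3) = rr q (tt q 0 0 * tt q i m) := by
  rw [rr_swap q hi hm (by decide) (by decide), rr_33]

lemma sw_32 {i m : Fin 4} (hi : i < 2) (hm : m < 2) :
    rr q (tt q i m * tt q 3 2) = - rr q (tt q 0 1 * tt q i m) := by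
  rw [rr_swap q hi hm (by decide) (by decide), rr_32]

lemma sw_23 {i m : Fin 4} (hi : i < 2) (hm : m < 2) :
    rr q (tt q i m * tt q 2 3) = - rr q (tt q 1 0 * tt q i m) := by
  rw [rr_swap q hi hm (by decide) (by decide), rr_23]

lemma rr_tr {i m k l : Fin 4} (hi : i < 2) (hm : m < 2) (hk : k < 2) (hl : 2 ≤ l) :
    rr q (tt q i m * tt q k l) = 0 := by
  have hml := hm.trans_le hl
  rcases lt_trichotomy i k with h | h | h
  · rw [tt_qcom q h hml, ← tt_comm q h hml, map_add, map_smul, rr_zero q (Or.inl ⟨hk, hl⟩),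
      rr_zero q (Or.inl ⟨hi, hl⟩), smul_zero, add_zero]
  · subst h
    rw [tt_row q hml, map_smul, rr_zero q (Or.inl ⟨hi, hl⟩), smul_zero]
  · rw [← tt_comm q h hml, rr_zero q (Or.inl ⟨hk, hl⟩)]

lemma rr_bl {i m k l : Fin 4} (hi : i < 2) (hm : m < 2) (hk : k < 2) (hl : 2 ≤ l) :
    rr q (tt q i m * tt q l k) = 0 := by
  have hil := hi.trans_le hl
  rcases lt_trichotomy m k with h | h | h
  · rw [tt_qcom q hil h, map_add, map_smul, rr_zero q (Or.inr ⟨hl, hk⟩),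
      rr_zero q (Or.inr ⟨hl, hm⟩), smul_zero, add_zero]
  · subst h
    rw [tt_col q hil, map_smul, rr_zero q (Or.inr ⟨hl, hm⟩), smul_zero]
  · rw [tt_comm q hil h, rr_zero q (Or.inr ⟨hl, hk⟩)]

lemma rr_11_00 : rr q (tt q 1 1 * tt q 0 0) = (q : ℂ)⁻¹ • rr q (tt q 0 1 * tt q 1 0) + rr q 1 := by
  have h := congrArg (rr q) (tt_qcom q (i := 0) (j := 1) (k := 0) (l := 1) (by decide) (by decide))
  rw [map_add, map_smul, rr_det,
    ← tt_comm q (i := 0) (j := 1) (k := 0) (l := 1) (by decide) (by decide)] at h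
  rw [← sub_eq_iff_eq_add] at h
  rw [← h, sub_smul]; abel

/-- Kronecker symbol as a complex number. -/
def kd (i j : Fin 4) : ℂ := if i = j then 1 else 0

lemma q00 (hq : (q : ℂ) ≠ 0) (k : Fin 4) :
    rr q (tt q 0 0 * tt q k 2 + (q : ℂ)⁻¹ • (tt q 0 1 * tt q k 3)) = kd k 2 • rr q 1 := by
  rw [map_add, map_smul]
  fin_cases k <;> simp only [Fin.reduceFinMk, Fin.zero_eta, Fin.mk_one]
  · rw [rr_tr, rr_tr] <;> simp [kd]
  · rw [rr_tr, rr_tr] <;> simp [kd]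
  · rw [sw_22, sw_23, rr_11_00, ← tt_comm q (i := 0) (j := 1) (k := 0) (l := 1)]
      <;> simp [kd]
  · rw [sw_32, sw_33, tt_row q (i := 0) (j := 1) (k := 0)] <;> simp [kd, hq, -Complex.coe_smul]

lemma q10 (hq : (q : ℂ) ≠ 0) (k : Fin 4) :
    rr q (tt q 1 0 * tt q k 2 + (q : ℂ)⁻¹ • (tt q 1 1 * tt q k 3)) =
      ((q : ℂ)⁻¹ * kd k 3) • rr q 1 := by
  rw [map_add, map_smul]
  fin_cases k <;> simp only [Fin.reduceFinMk, Fin.zero_eta, Fin.mk_one]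
  · rw [rr_tr, rr_tr] <;> simp [kd]
  · rw [rr_tr, rr_tr] <;> simp [kd]
  · rw [sw_22, sw_23, tt_row q (i := 0) (j := 1) (k := 1)] <;> simp [kd, hq, -Complex.coe_smul]
  · rw [sw_32, sw_33, rr_det] <;> simp [kd, hq, -Complex.coe_smul]

lemma p00 (hq : (q : ℂ) ≠ 0) (k : Fin 4) :
    rr q (tt q 0 0 * tt q 2 k + (q : ℂ)⁻¹ • (tt q 1 0 * tt q 3 k)) = kd 2 k • rr q 1 := by
  rw [map_add, map_smul]
  fin_cases k <;> simp only [Fin.reduceFinMk, Fin.zero_eta, Fin.mk_one]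
  · rw [rr_bl, rr_bl] <;> simp [kd]
  · rw [rr_bl, rr_bl] <;> simp [kd]
  · rw [sw_22, sw_32, rr_11_00] <;> simp [kd]
  · rw [sw_23, sw_33, tt_col q (i := 0) (j := 1) (k := 0)] <;> simp [kd, hq, -Complex.coe_smul]

lemma p01 (hq : (q : ℂ) ≠ 0) (k : Fin 4) :
    rr q (tt q 0 1 * tt q 2 k + (q : ℂ)⁻¹ • (tt q 1 1 * tt q 3 k)) =
      ((q : ℂ)⁻¹ * kd 3 k) • rr q 1 := by
  rw [map_add, map_smul]
  fin_cases k <;> simp only [Fin.reduceFinMk, Fin.zero_eta, Fin.mk_one]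
  · rw [rr_bl, rr_bl] <;> simp [kd]
  · rw [rr_bl, rr_bl] <;> simp [kd]
  · rw [sw_22, sw_32, tt_col q (i := 0) (j := 1) (k := 1)] <;> simp [kd, hq, -Complex.coe_smul]
  · rw [sw_23, sw_33, rr_det, ← tt_comm q (i := 0) (j := 1) (k := 0) (l := 1)]
      <;> simp [kd, hq, -Complex.coe_smul]

section antipode

variable (S : AU q →ₗ[ℂ] AU q)

/-- Summing a product against the antipode. -/
lemma rr_S (hSright : ∀ i j : Fin 4, ∑ k : Fin 4, tt q i k * S (tt q k j) = if i = j then 1 else 0)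
    (j m n : Fin 4) (x y : AU q) (s : ℂ) (f : Fin 4 → ℂ)
    (h : ∀ k, rr q (x * tt q m k + s • (y * tt q n k)) = f k • rr q 1) :
    rr q (kd m j • x + (s * kd n j) • y) = ∑ k, f k • rr q (S (tt q k j)) := by
  have hk : ∀ k, f k • rr q (S (tt q k j)) =
      rr q (x * (tt q m k * S (tt q k j)) + s • (y * (tt q n k * S (tt q k j)))) := by
    intro k
    have := rr_congr q (x := x * tt q m k + s • (y * tt q n k)) (y := f k • 1)
      (by rw [h, map_smul]) (S (tt q k j))
    rw [smul_mul_assoc, one_mul, map_smul] at this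
    rw [← this, add_mul, smul_mul_assoc, mul_assoc, mul_assoc]
  rw [Finset.sum_congr rfl fun k _ => hk k, ← map_sum, Finset.sum_add_distrib, ← Finset.smul_sum,
    ← Finset.mul_sum, ← Finset.mul_sum, hSright, hSright]
  congr 2
  · by_cases e : m = j <;> simp [kd, e]
  · by_cases e : n = j <;> simp [kd, e]

lemma rr_S2 (hq : (q : ℂ) ≠ 0)
    (hSright : ∀ i j : Fin 4, ∑ k : Fin 4, tt q i k * S (tt q k j) = if i = j then 1 else 0)
    (j : Fin 4) :
    rr q (S (tt q 2 j)) = rr q (kd 2 j • tt q 0 0 + ((q : ℂ)⁻¹ * kd 3 j) • tt q 1 0) := by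
  rw [rr_S q S hSright j 2 3 _ _ _ _ (p00 q hq)]
  simp [kd]

lemma rr_S3 (hq : (q : ℂ) ≠ 0)
    (hSright : ∀ i j : Fin 4, ∑ k : Fin 4, tt q i k * S (tt q k j) = if i = j then 1 else 0)
    (j : Fin 4) :
    rr q ((q : ℂ)⁻¹ • S (tt q 3 j)) =
      rr q (kd 2 j • tt q 0 1 + ((q : ℂ)⁻¹ * kd 3 j) • tt q 1 1) := by
  rw [rr_S q S hSright j 2 3 _ _ _ _ (p01 q hq)]
  simp [kd]

lemma rr_right
    (hSright : ∀ i j : Fin 4, ∑ k : Fin 4, tt q i k * S (tt q k j) = if i = j then 1 else 0)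
    (i k : Fin 4) : ∑ l, rr q (tt q i l * S (tt q l k)) = kd i k • rr q 1 := by
  rw [← map_sum, hSright]
  by_cases e : i = k <;> simp [kd, e]

lemma rr_top
    (hSright : ∀ i j : Fin 4, ∑ k : Fin 4, tt q i k * S (tt q k j) = if i = j then 1 else 0)
    {i : Fin 4} (hi : i < 2) (k : Fin 4) :
    rr q (tt q i 0 * S (tt q 0 k)) + rr q (tt q i 1 * S (tt q 1 k)) = kd i k • rr q 1 := by
  rw [← rr_right q S hSright, Fin.sum_univ_four, rr_zero q (j := 2) (Or.inl ⟨hi, by decide⟩),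
    rr_zero q (j := 3) (Or.inl ⟨hi, by decide⟩), add_zero, add_zero]

lemma rr_bot
    (hSright : ∀ i j : Fin 4, ∑ k : Fin 4, tt q i k * S (tt q k j) = if i = j then 1 else 0)
    {i : Fin 4} (hi : 2 ≤ i) (k : Fin 4) :
    rr q (tt q i 2 * S (tt q 2 k)) + rr q (tt q i 3 * S (tt q 3 k)) = kd i k • rr q 1 := by
  rw [← rr_right q S hSright, Fin.sum_univ_four, rr_zero q (j := 0) (Or.inr ⟨hi, by decide⟩),
    rr_zero q (j := 1) (Or.inr ⟨hi, by decide⟩), zero_add, zero_add]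

lemma coef_R
    (hSright : ∀ i j : Fin 4, ∑ k : Fin 4, tt q i k * S (tt q k j) = if i = j then 1 else 0)
    (j k : Fin 4) :
    rr q (tt q j 0 * S (tt q 0 k) + (1 : ℂ) • (tt q j 1 * S (tt q 1 k))) =
      (kd j 0 * kd 0 k + kd j 1 * kd 1 k) • rr q 1 := by
  rw [map_add, one_smul]
  fin_cases j <;> simp only [Fin.reduceFinMk, Fin.zero_eta, Fin.mk_one]
  · rw [rr_top q S hSright (by decide)]; simp [kd]
  · rw [rr_top q S hSright (by decide)]; simp [kd]
  · rw [rr_zero q (by decide), rr_zero q (by decide)]; simp [kd]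
  · rw [rr_zero q (by decide), rr_zero q (by decide)]; simp [kd]

lemma coef_a
    (hSright : ∀ i j : Fin 4, ∑ k : Fin 4, tt q i k * S (tt q k j) = if i = j then 1 else 0)
    (j k : Fin 4) :
    rr q (tt q j 0 * S (tt q 3 k) + (-1 : ℂ) • (tt q j 1 * S (tt q 2 k))) =
      (kd j 0 * kd 3 k - kd j 1 * kd 2 k) • rr q 1 := by
  rw [map_add, map_smul]
  fin_cases j <;> simp only [Fin.reduceFinMk, Fin.zero_eta, Fin.mk_one]
  · have := rr_bot q S hSright (i := 3) (by decide) k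
    rw [rr_33, rr_32] at this
    simpa [kd, add_comm] using this
  · have := rr_bot q S hSright (i := 2) (by decide) k
    rw [rr_23, rr_22] at this
    simpa [kd, add_comm] using congrArg (fun x => - x) this
  · rw [rr_zero q (by decide), rr_zero q (by decide)]; simp [kd]
  · rw [rr_zero q (by decide), rr_zero q (by decide)]; simp [kd]

lemma coef_as
    (hSright : ∀ i j : Fin 4, ∑ k : Fin 4, tt q i k * S (tt q k j) = if i = j then 1 else 0)
    (j k : Fin 4) :
    rr q (tt q j 3 * S (tt q 0 k) + (-1 : ℂ) • (tt q j 2 * S (tt q 1 k))) =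
      (kd j 3 * kd 0 k - kd j 2 * kd 1 k) • rr q 1 := by
  rw [map_add, map_smul]
  fin_cases j <;> simp only [Fin.reduceFinMk, Fin.zero_eta, Fin.mk_one]
  · rw [rr_zero q (by decide), rr_zero q (by decide)]; simp [kd]
  · rw [rr_zero q (by decide), rr_zero q (by decide)]; simp [kd]
  · have := rr_top q S hSright (i := 1) (by decide) k
    rw [rr_23, rr_22]
    simpa [kd, add_comm] using congrArg (fun x => - x) this
  · have := rr_top q S hSright (i := 0) (by decide) k
    rw [rr_33, rr_32]
    simpa [kd, add_comm] using this

lemma coef_b (hq : (q : ℂ) ≠ 0) (j k : Fin 4) :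
    rr q (tt q j 0 * tt q k 2 + (q : ℂ)⁻¹ • (tt q j 1 * tt q k 3)) =
      (kd j 0 * kd k 2 + (q : ℂ)⁻¹ * (kd j 1 * kd k 3)) • rr q 1 := by
  fin_cases j <;> simp only [Fin.reduceFinMk, Fin.zero_eta, Fin.mk_one]
  · rw [q00 q hq]; simp [kd]
  · rw [q10 q hq]; simp [kd]
  · rw [map_add, map_smul, rr_zero q (by decide), rr_zero q (by decide)]; simp [kd]
  · rw [map_add, map_smul, rr_zero q (by decide), rr_zero q (by decide)]; simp [kd]

lemma coef_bs (hq : (q : ℂ) ≠ 0)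
    (hSright : ∀ i j : Fin 4, ∑ k : Fin 4, tt q i k * S (tt q k j) = if i = j then 1 else 0)
    (j k : Fin 4) :
    rr q (S (tt q 2 j) * S (tt q 0 k) + (q : ℂ)⁻¹ • (S (tt q 3 j) * S (tt q 1 k))) =
      (kd 2 j * kd 0 k + (q : ℂ)⁻¹ * (kd 3 j * kd 1 k)) • rr q 1 := by
  rw [map_add, ← smul_mul_assoc, rr_congr q (rr_S2 q S hq hSright j),
    rr_congr q (rr_S3 q S hq hSright j)]
  have h0 := rr_top q S hSright (i := 0) (by decide) k
  have h1 := rr_top q S hSright (i := 1) (by decide) k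
  rw [add_smul, mul_smul (kd 2 j) (kd 0 k), ← mul_assoc, mul_smul _ (kd 1 k), ← h0, ← h1]
  simp only [add_mul, smul_mul_assoc, map_add, map_smul, smul_add]
  abel

end antipode

/-- `Δ_r` on quadratic expressions. -/
lemma Dr_quad (x y x' y' : PA q) (u w : Fin 4 → PA q) (a b a' b' : Fin 4 → AU q) (s : ℂ)
    (hx : δ x = ∑ j, u j ⊗ₜ[ℂ] a j) (hy : δ y = ∑ k, w k ⊗ₜ[ℂ] b k)
    (hx' : δ x' = ∑ j, u j ⊗ₜ[ℂ] a' j) (hy' : δ y' = ∑ k, w k ⊗ₜ[ℂ] b' k)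
    (F : Fin 4 → Fin 4 → ℂ)
    (hF : ∀ j k, rr q (a j * b k + s • (a' j * b' k)) = F j k • rr q 1) :
    Dr q δ (x * y + s • (x' * y')) = (∑ j, ∑ k, F j k • (u j * w k)) ⊗ₜ[ℂ] rr q 1 := by
  have h : δ (x * y + s • (x' * y')) =
      ∑ j, ∑ k, (u j * w k) ⊗ₜ[ℂ] (a j * b k + s • (a' j * b' k)) := by
    rw [map_add, map_smul, map_mul, map_mul, hx, hy, hx', hy', Finset.sum_mul_sum,
      Finset.sum_mul_sum]
    simp only [Algebra.TensorProduct.tmul_mul_tmul, TensorProduct.tmul_add, TensorProduct.tmul_smul,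
      Finset.sum_add_distrib, Finset.smul_sum]
  rw [Dr, LinearMap.comp_apply, AlgHom.toLinearMap_apply, h]
  simp only [map_sum, LinearMap.lTensor_tmul, hF, TensorProduct.sum_tmul, TensorProduct.tmul_smul,
    TensorProduct.smul_tmul']

end helpers

set_option maxHeartbeats 2000000 in
theorem generators_of_sphere_coinvariant (q : ℝ) (hq0 : 0 < q) (hq1 : q < 1)
    [StarRing (AU q)] [StarModule ℂ (AU q)]
    (S : AU q →ₗ[ℂ] AU q)
    (hSanti : ∀ x y : AU q, S (x * y) = S y * S x) (hS1 : S 1 = 1)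
    (hSleft : ∀ i j : Fin 4, ∑ k : Fin 4, S (tt q i k) * tt q k j = if i = j then 1 else 0)
    (hSright : ∀ i j : Fin 4, ∑ k : Fin 4, tt q i k * S (tt q k j) = if i = j then 1 else 0)
    (hSD : S (Dq q) = dI q) (hSDi : S (dI q) = Dq q)
    (hstarT : ∀ i j : Fin 4, star (tt q i j) = S (tt q j i))
    (hstarD : star (Dq q) = dI q)
    [StarRing (PA q)] [StarModule ℂ (PA q)]
    (hstarz : ∀ i : Fin 4, star (z q i) = zs q i)
    (δ : PA q →ₐ[ℂ] PA q ⊗[ℂ] AU q)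
    (hδz : ∀ i : Fin 4, δ (z q i) = ∑ j : Fin 4, z q j ⊗ₜ[ℂ] tt q j i)
    (hδzs : ∀ i : Fin 4, δ (zs q i) = ∑ j : Fin 4, zs q j ⊗ₜ[ℂ] star (tt q j i))
    : Dr q δ (aa q) = aa q ⊗ₜ[ℂ] rr q 1 ∧
    Dr q δ (bb q) = bb q ⊗ₜ[ℂ] rr q 1 ∧
    Dr q δ (RRe q) = RRe q ⊗ₜ[ℂ] rr q 1 ∧
    aa q ∈ Bset q δ ∧ star (aa q) ∈ Bset q δ ∧ bb q ∈ Bset q δ ∧ star (bb q) ∈ Bset q δ ∧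
    RRe q ∈ Bset q δ := by
  have hq : (q : ℂ) ≠ 0 := by exact_mod_cast hq0.ne'
  have hδs : ∀ i : Fin 4, δ (star (z q i)) = ∑ j : Fin 4, star (z q j) ⊗ₜ[ℂ] S (tt q i j) := by
    intro i
    simp only [hstarz, hδzs, hstarT]
  have ha : Dr q δ (aa q) = aa q ⊗ₜ[ℂ] rr q 1 := by
    have := Dr_quad q δ _ _ _ _ _ _ _ _ _ _ (-1) (hδz 0) (hδs 3) (hδz 1) (hδs 2) _
      (coef_a q S hSright)
    simpa [kd, Fin.sum_univ_four, aa, sub_eq_add_neg] using this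
  have has : Dr q δ (star (aa q)) = star (aa q) ⊗ₜ[ℂ] rr q 1 := by
    have := Dr_quad q δ _ _ _ _ _ _ _ _ _ _ (-1) (hδz 3) (hδs 0) (hδz 2) (hδs 1) _
      (coef_as q S hSright)
    simpa [kd, Fin.sum_univ_four, aa, sub_eq_add_neg, add_comm] using this
  have hR : Dr q δ (RRe q) = RRe q ⊗ₜ[ℂ] rr q 1 := by
    have := Dr_quad q δ _ _ _ _ _ _ _ _ _ _ 1 (hδz 0) (hδs 0) (hδz 1) (hδs 1) _
      (coef_R q S hSright)
    simpa [kd, Fin.sum_univ_four, RRe] using this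
  have hb : Dr q δ (bb q) = bb q ⊗ₜ[ℂ] rr q 1 := by
    have := Dr_quad q δ _ _ _ _ _ _ _ _ _ _ (q : ℂ)⁻¹ (hδz 0) (hδz 2) (hδz 1) (hδz 3) _
      (coef_b q hq)
    simpa [kd, Fin.sum_univ_four, bb] using this
  have hbs : Dr q δ (star (bb q)) = star (bb q) ⊗ₜ[ℂ] rr q 1 := by
    have := Dr_quad q δ _ _ _ _ _ _ _ _ _ _ (q : ℂ)⁻¹ (hδs 2) (hδs 0) (hδs 3) (hδs 1) _
      (coef_bs q S hq hSright)
    have e : star (bb q) =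
        star (z q 2) * star (z q 0) + (q : ℂ)⁻¹ • (star (z q 3) * star (z q 1)) := by
      rw [bb, star_add, star_smul, star_mul, star_mul]
      congr 2
      simp
    rw [e]
    simpa [kd, Fin.sum_univ_four] using this
  exact ⟨ha, hb, hR, ha, has, hb, hbs, hR⟩

end QIB
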